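/- (Termination) For every clause set F, every derivation sequence starting from the initial family of clause sets S₀ = {F} obtained by repeatedly applying the inference rules A1, A2, and A3 is finite; that is, the reasoning algorithm with A1, A2, and A3 terminates on every input. -/

import Mathlib

/- Clause sets in ALC: a clause set is a finite set of clauses, a clause a
   finite set of concept literals (both represented by lists, with list
   membership as set membership, `++` as union and `filter` as removal). -/
namespace ALCCS

/-- Concept literals: A, ¬A, ∃R.F, ∀R.F where F is a clause set
    (concept names and role names are drawn from ℕ). -/
inductive Lit : Type where
  | pos : ℕ → Lit                    -- concept name A
  | neg : ℕ → Lit                    -- negated concept name ¬A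
  | ex  : ℕ → List (List Lit) → Lit  -- ∃R.F
  | all : ℕ → List (List Lit) → Lit  -- ∀R.F

/-- A clause: a finite set of concept literals (their disjunction). -/
abbrev Clause := List Lit
/-- A clause set: a finite set of clauses (their conjunction). -/
abbrev ClauseSet := List (List Lit)

/-- An interpretation with (nonempty) domain `D`. -/
structure Interp (D : Type) where
  cn  : ℕ → Set D
  rel : ℕ → D → D → Prop

mutual
/-- The extension L^I of a concept literal. -/
def litSem {D : Type} (I : Interp D) : Lit → Set D
  | .pos a => I.cn a
  | .neg a => (I.cn a)ᶜ
  | .ex r F => {x | ∃ y, I.rel r x y ∧ y ∈ csSem I F}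
  | .all r F => {x | ∀ y, I.rel r x y → y ∈ csSem I F}
/-- The extension of a clause: the union (disjunction) of its literals. -/
def clSem {D : Type} (I : Interp D) : List Lit → Set D
  | [] => ∅
  | L :: CL => litSem I L ∪ clSem I CL
/-- The extension of a clause set: the intersection (conjunction) of its clauses. -/
def csSem {D : Type} (I : Interp D) : List (List Lit) → Set D
  | [] => Set.univ
  | CL :: F => clSem I CL ∩ csSem I F
end

/-- A clause set is satisfiable if F^I ≠ ∅ for some interpretation. -/
def Satisfiable (F : ClauseSet) : Prop :=
  ∃ (D : Type), Nonempty D ∧ ∃ I : Interp D, (csSem I F).Nonempty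

/-- CNF of a disjunction of two clause sets (pairwise union of clauses). -/
def disjCS (F₁ F₂ : ClauseSet) : ClauseSet :=
  F₁.flatMap (fun c₁ => F₂.map (fun c₂ => c₁ ++ c₂))

mutual
/-- The complementary literal L̄: Ā = ¬A, (¬A)‾ = A, (∃R.F)‾ = ∀R.CNF(¬F),
    (∀R.F)‾ = ∃R.CNF(¬F). -/
def Lit.compl : Lit → Lit
  | .pos a => .neg a
  | .neg a => .pos a
  | .ex r F => .all r (csNeg F)
  | .all r F => .ex r (csNeg F)
/-- CNF of the negation of a clause: the conjunction of the complements. -/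
def clNeg : List Lit → List (List Lit)
  | [] => []
  | L :: CL => [L.compl] :: clNeg CL
/-- CNF(¬F) for a clause set F. -/
def csNeg : List (List Lit) → List (List Lit)
  | [] => [[]]
  | CL :: F => disjCS (clNeg CL) (csNeg F)
end

open Classical in
/-- Replace the clause `CL` by `newCL` in the clause set `F`. -/
noncomputable def replaceClause (F : ClauseSet) (CL newCL : Clause) : ClauseSet :=
  F.map (fun c => if c = CL then newCL else c)

open Classical in
/-- Replace the clause set `F` by `F'` in the family `S`. -/
noncomputable def replaceCS (S : List ClauseSet) (F F' : ClauseSet) : List ClauseSet :=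
  S.map (fun G => if G = F then F' else G)

open Classical in
/-- F \ {CL} : remove the clause `CL` from the clause set `F`. -/
noncomputable def removeClause (F : ClauseSet) (CL : Clause) : ClauseSet :=
  F.filter (fun c => decide (c ≠ CL))

open Classical in
/-- The effect of rule A2 (and A2⁺) on F for ∀R.F₁: remove from F all clauses
    containing ∀R.F₁ and replace every occurrence of ∃R.F₂ in clauses of F by
    ∃R.(F₁ ∪ F₂). -/
noncomputable def applyA2 (r : ℕ) (F₁ : ClauseSet) (F : ClauseSet) : ClauseSet :=
  (F.filter (fun CL => decide (Lit.all r F₁ ∉ CL))).map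
    (fun CL => CL.map (fun L => match L with
      | .ex r' F₂ => if r' = r then Lit.ex r' (F₁ ++ F₂) else Lit.ex r' F₂
      | L => L))

/-- A unit clause of the form {A}, {¬A}, or {∃R.F'}. -/
def IsA3Unit (CL : Clause) : Prop :=
  (∃ a, CL = [Lit.pos a]) ∨ (∃ a, CL = [Lit.neg a]) ∨ ∃ r F', CL = [Lit.ex r F']

/-- A family of clause sets is clash-free if none of its clause sets contains an
    empty clause or a pair {L}, {L̄} of complementary unit clauses. -/
def ClashFree (S : List ClauseSet) : Prop :=
  ∀ F ∈ S, [] ∉ F ∧ ¬ ∃ L : Lit, [L] ∈ F ∧ [L.compl] ∈ F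

/-- One derivation step Sᵢ → Sᵢ₊₁ of the reasoning algorithm with the inference
    rules A1, A2, and A3, acting on a clause set F ∈ Sᵢ. -/
inductive Step : List ClauseSet → List ClauseSet → Prop
  /-- (A1) if L ∈ CL for a clause CL of F (with |CL| ≥ 2), replace CL by {L} -/
  | a1 {S : List ClauseSet} {F : ClauseSet} {CL : Clause} {L : Lit} :
      F ∈ S → CL ∈ F → L ∈ CL → 2 ≤ CL.length →
      Step S (replaceCS S F (replaceClause F CL [L]))
  /-- (A2) if ∀R.F₁ occurs in some clause of F, remove all clauses containing
      ∀R.F₁ and replace every ∃R.F₂ by ∃R.(F₁ ∪ F₂) -/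
  | a2 {S : List ClauseSet} {F : ClauseSet} {CL : Clause} {r : ℕ} {F₁ : ClauseSet} :
      F ∈ S → CL ∈ F → Lit.all r F₁ ∈ CL →
      Step S (replaceCS S F (applyA2 r F₁ F))
  /-- (A3) if all clauses of F are unit clauses {A}, {¬A}, or {∃R.F'}, remove a
      unit clause {∃R.F₁} from F and add F₁ to the family -/
  | a3 {S : List ClauseSet} {F : ClauseSet} {r : ℕ} {F₁ : ClauseSet} :
      F ∈ S → (∀ CL ∈ F, IsA3Unit CL) → [Lit.ex r F₁] ∈ F →
      Step S (replaceCS S F (removeClause F [Lit.ex r F₁]) ++ [F₁])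

/-- A family is complete if no inference rule applies to it. -/
def Complete (S : List ClauseSet) : Prop := ¬ ∃ S', Step S S'

mutual
/-- The role depth of a concept literal. -/
def litDepth : Lit → ℕ
  | .pos _ => 0
  | .neg _ => 0
  | .ex _ F => csDepth F + 1
  | .all _ F => csDepth F + 1
/-- The maximal role depth of the literals of a clause. -/
def clDepth : List Lit → ℕ
  | [] => 0
  | L :: CL => max (litDepth L) (clDepth CL)
/-- The maximal role depth of the literals of a clause set. -/
def csDepth : List (List Lit) → ℕ
  | [] => 0
  | CL :: F => max (clDepth CL) (csDepth F)
end

theorem clDepth_le_iff {CL : Clause} {n : ℕ} :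
    clDepth CL ≤ n ↔ ∀ L ∈ CL, litDepth L ≤ n := by
  induction CL with
  | nil => simp [clDepth]
  | cons L CL ih => simp [clDepth, ih]

theorem csDepth_le_iff {F : ClauseSet} {n : ℕ} :
    csDepth F ≤ n ↔ ∀ CL ∈ F, ∀ L ∈ CL, litDepth L ≤ n := by
  induction F with
  | nil => simp [csDepth]
  | cons CL F ih => simp [csDepth, ih, clDepth_le_iff]

theorem litDepth_le_csDepth {F : ClauseSet} {CL : Clause} {L : Lit} (hCL : CL ∈ F)
    (hL : L ∈ CL) : litDepth L ≤ csDepth F :=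
  csDepth_le_iff.1 le_rfl CL hCL L hL

theorem csDepth_append (F G : ClauseSet) : csDepth (F ++ G) = max (csDepth F) (csDepth G) := by
  induction F with
  | nil => simp [csDepth]
  | cons CL F ih => simp [csDepth, ih, max_assoc]

/-- The number of literal occurrences in a clause set. -/
def litCount (F : ClauseSet) : ℕ := (F.map List.length).sum

theorem litCount_map_map (F : ClauseSet) (f : Lit → Lit) :
    litCount (F.map (fun CL => CL.map f)) = litCount F := by
  simp only [litCount, List.map_map, Function.comp_def, List.length_map]

theorem litCount_filter_lt {F : ClauseSet} {CL : Clause} {p : Clause → Bool} (hCL : CL ∈ F)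
    (hne : CL ≠ []) (hp : p CL = false) : litCount (F.filter p) < litCount F := by
  have hle (G : ClauseSet) : litCount (G.filter p) ≤ litCount G :=
    (List.filter_sublist.map List.length).sum_le_sum (by simp)
  obtain ⟨F₁, F₂, rfl⟩ := List.append_of_mem hCL
  have h₁ := hle F₁
  have h₂ := hle F₂
  have h₃ := List.length_pos_iff.2 hne
  simp only [litCount, List.filter_append, List.filter_cons, hp, List.map_append, List.map_cons,
    List.sum_append, List.sum_cons] at h₁ h₂ ⊢
  simp only [Bool.false_eq_true, if_false]
  omega

theorem csDepth_filter_le (F : ClauseSet) (p : Clause → Bool) :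
    csDepth (F.filter p) ≤ csDepth F :=
  csDepth_le_iff.2 fun _ hCL _ hL => litDepth_le_csDepth (List.mem_of_mem_filter hCL) hL

/-- The role depth of a clause set and its number of literal occurrences, compared
lexicographically. -/
def rank (F : ClauseSet) : ℕ ×ₗ ℕ := toLex (csDepth F, litCount F)

theorem rank_lt_of_csDepth_lt {F G : ClauseSet} (h : csDepth F < csDepth G) : rank F < rank G :=
  Prod.Lex.toLex_lt_toLex.2 (Or.inl h)

theorem rank_lt_of_litCount_lt {F G : ClauseSet} (hd : csDepth F ≤ csDepth G)
    (hc : litCount F < litCount G) : rank F < rank G :=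
  Prod.Lex.toLex_lt_toLex.2 (hd.lt_or_eq.imp id fun h => ⟨h, hc⟩)

theorem rank_replaceClause_lt {F : ClauseSet} {CL : Clause} {L : Lit} (hCL : CL ∈ F)
    (hL : L ∈ CL) (hlen : 2 ≤ CL.length) : rank (replaceClause F CL [L]) < rank F := by
  apply rank_lt_of_litCount_lt
  · rw [csDepth_le_iff]
    intro C hC M hM
    obtain ⟨c, hc, rfl⟩ := List.mem_map.1 hC
    split_ifs at hM with h
    · rw [List.mem_singleton.1 hM]
      exact litDepth_le_csDepth hCL hL
    · exact litDepth_le_csDepth hc hM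
  · simp only [litCount, replaceClause, List.map_map]
    refine List.sum_lt_sum _ _ (fun c _ => ?_) ⟨CL, hCL, ?_⟩
    · simp only [Function.comp_apply]
      split_ifs with h
      · subst h
        simp only [List.length_singleton]
        omega
      · exact le_rfl
    · simp only [Function.comp_apply, if_true, List.length_singleton]
      omega

theorem rank_applyA2_lt {F F₁ : ClauseSet} {CL : Clause} {r : ℕ} (hCL : CL ∈ F)
    (hL : Lit.all r F₁ ∈ CL) : rank (applyA2 r F₁ F) < rank F := by
  apply rank_lt_of_litCount_lt
  · rw [csDepth_le_iff]
    intro C hC M hM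
    obtain ⟨c, hc, rfl⟩ := List.mem_map.1 hC
    obtain ⟨K, hK, rfl⟩ := List.mem_map.1 hM
    have hd := litDepth_le_csDepth (List.mem_of_mem_filter hc) hK
    have hd₁ := litDepth_le_csDepth hCL hL
    cases K with
    | ex r' F₂ =>
      simp only [litDepth] at hd hd₁
      dsimp only
      split_ifs
      · simp only [litDepth, csDepth_append]
        omega
      · simpa only [litDepth] using hd
    | _ => exact hd
  · rw [applyA2, litCount_map_map]
    exact litCount_filter_lt hCL (List.ne_nil_of_mem hL) (by simpa using hL)

theorem rank_removeClause_lt {F : ClauseSet} {CL : Clause} (hCL : CL ∈ F) (hne : CL ≠ []) :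
    rank (removeClause F CL) < rank F :=
  rank_lt_of_litCount_lt (csDepth_filter_le _ _) (litCount_filter_lt hCL hne (by simp))

/-- The multiset of the ranks of the clause sets of a family. -/
def familyRank (S : List ClauseSet) : Multiset (ℕ ×ₗ ℕ) := (S.map rank : List (ℕ ×ₗ ℕ))

theorem familyRank_replaceCS_append_lt {S T : List ClauseSet} {F F' : ClauseSet} (hF : F ∈ S)
    (hF' : rank F' < rank F) (hT : ∀ G ∈ T, rank G < rank F) :
    Multiset.IsDershowitzMannaLT (familyRank (replaceCS S F F' ++ T)) (familyRank S) := by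
  classical
  have hsplit (f : ClauseSet → ClauseSet) : familyRank (S.map f) =
      familyRank ((S.filter (· ≠ F)).map f) + familyRank ((S.filter (· = F)).map f) := by
    simp only [familyRank, ← Multiset.map_coe, ← Multiset.filter_coe, ← Multiset.map_add]
    rw [add_comm, Multiset.filter_add_not]
  refine ⟨familyRank (S.filter (· ≠ F)),
    familyRank ((S.filter (· = F)).map fun _ => F') + familyRank T,
    familyRank (S.filter (· = F)), ?_, ?_, ?_, ?_⟩
  · simpa [familyRank] using hF
  · have happ : familyRank (replaceCS S F F' ++ T)
        = familyRank (replaceCS S F F') + familyRank T := by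
      simp [familyRank]
    rw [happ, ← add_assoc, replaceCS, hsplit]
    congr 2
    · congr 1
      refine (List.map_congr_left fun G hG => ?_).trans (List.map_id _)
      simpa using fun h => absurd h (by simpa using List.of_mem_filter hG)
    · congr 1
      refine List.map_congr_left fun G hG => ?_
      rw [if_pos (by simpa using List.of_mem_filter hG)]
  · simpa using hsplit id
  · intro y hy
    refine ⟨rank F, by simpa [familyRank] using hF, ?_⟩
    rcases Multiset.mem_add.1 hy with hy | hy <;>
      obtain ⟨G, hG, rfl⟩ := List.mem_map.1 (Multiset.mem_coe.1 hy)
    · obtain ⟨_, _, rfl⟩ := List.mem_map.1 hG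
      exact hF'
    · exact hT G hG

theorem Step.familyRank_lt {S S' : List ClauseSet} (h : Step S S') :
    Multiset.IsDershowitzMannaLT (familyRank S') (familyRank S) := by
  cases h with
  | a1 hF hCL hL hlen =>
    simpa using familyRank_replaceCS_append_lt (T := []) hF (rank_replaceClause_lt hCL hL hlen)
  | a2 hF hCL hL =>
    simpa using familyRank_replaceCS_append_lt (T := []) hF (rank_applyA2_lt hCL hL)
  | a3 hF _ hL =>
    refine familyRank_replaceCS_append_lt hF (rank_removeClause_lt hL (by simp)) fun G hG => ?_
    rw [List.mem_singleton.1 hG]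
    have hd := litDepth_le_csDepth hL (List.mem_singleton.2 rfl)
    rw [litDepth] at hd
    exact rank_lt_of_csDepth_lt hd

/-- Termination: every derivation sequence starting from
    S₀ = {F} by the rules A1, A2, and A3 is finite, i.e. there is no infinite
    derivation sequence. -/
theorem termination_A1_A2_A3 (F : ClauseSet) :
    ¬ ∃ seq : ℕ → List ClauseSet, seq 0 = [F] ∧ ∀ i, Step (seq i) (seq (i + 1)) := by
  rintro ⟨seq, -, hseq⟩
  exact (wellFounded_iff_isEmpty_descending_chain.1
    (Multiset.wellFounded_isDershowitzMannaLT (α := ℕ ×ₗ ℕ))).false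
    ⟨fun i => familyRank (seq i), fun i => (hseq i).familyRank_lt⟩

end ALCCS
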